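/- Let d ≥ 2 and let f₁, …, f_d : ℝ → [0,∞) be Lebesgue-measurable log-concave functions. Define g : ℝ^{d−1} → [0,∞] by g(x) = ∫ (∏_{i=1}^{d−1} f_i(x_i + u))·f_d(u) du, the Lebesgue integral over u ∈ ℝ with values in the extended nonnegative reals. Then g is strongly MTP2 (with the defining inequality read in the extended nonnegative reals). -/

import Mathlib

open MeasureTheory
open scoped ENNReal

/-- Strong MTP₂ for `[0,∞]`-valued functions on `ℝ^n`, with the defining inequality read
in the extended nonnegative reals. -/
def StronglyMTP2ENN {n : ℕ} (g : (Fin n → ℝ) → ℝ≥0∞) : Prop :=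
  ∀ (x y : Fin n → ℝ) (α : ℝ), 0 ≤ α →
    g x * g y ≤ g (x ⊔ (y - α • (1 : Fin n → ℝ))) * g ((x + α • (1 : Fin n → ℝ)) ⊓ y)

/-- A function `h : ℝ → ℝ` is log-concave if
`h((1−λ)x + λy) ≥ h(x)^{1−λ}·h(y)^{λ}` for all `x, y` and `λ ∈ [0,1]`. -/
def LogConcaveFun (h : ℝ → ℝ) : Prop :=
  ∀ (x y l : ℝ), 0 ≤ l → l ≤ 1 →
    h x ^ (1 - l) * h y ^ l ≤ h ((1 - l) * x + l * y)

theorem LogConcaveFun.mul_le_mul_of_add_eq {h : ℝ → ℝ} (hlc : LogConcaveFun h)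
    (hnn : ∀ x, 0 ≤ h x) {a b c d : ℝ} (hac : a ≤ c) (hcb : c ≤ b) (hsum : a + b = c + d) :
    h a * h b ≤ h c * h d := by
  rcases eq_or_lt_of_le (hac.trans hcb) with rfl | hab
  · obtain rfl : c = a := le_antisymm hcb hac
    obtain rfl : d = c := by linarith
    exact le_rfl
  set l := (c - a) / (b - a) with hl
  have hba : 0 < b - a := sub_pos.2 hab
  have hl0 : 0 ≤ l := div_nonneg (sub_nonneg.2 hac) hba.le
  have hl1 : l ≤ 1 := (div_le_one hba).2 (by linarith)
  have hmul : l * (b - a) = c - a := div_mul_cancel₀ _ hba.ne'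
  have hc : (1 - l) * a + l * b = c := by linarith
  have hd : (1 - l) * b + l * a = d := by linarith
  have h₁ := hlc a b l hl0 hl1
  have h₂ := hlc b a l hl0 hl1
  rw [hc] at h₁
  rw [hd] at h₂
  have split (x : ℝ) : h x ^ (1 - l) * h x ^ l = h x := by
    rw [← Real.rpow_add_of_nonneg (hnn x) (sub_nonneg.2 hl1) hl0]
    simp
  calc h a * h b = (h a ^ (1 - l) * h a ^ l) * (h b ^ (1 - l) * h b ^ l) := by
        rw [split, split]
    _ = (h a ^ (1 - l) * h b ^ l) * (h b ^ (1 - l) * h a ^ l) := by ring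
    _ ≤ h c * h d := mul_le_mul h₁ h₂
        (mul_nonneg (Real.rpow_nonneg (hnn _) _) (Real.rpow_nonneg (hnn _) _)) (hnn _)

theorem LogConcaveFun.mul_le_sup_mul_inf {h : ℝ → ℝ} (hlc : LogConcaveFun h)
    (hnn : ∀ x, 0 ≤ h x) (x y : ℝ) {s t : ℝ} (hst : s ≤ t) :
    h (x + s) * h (y + t) ≤ h (x ⊔ y + s) * h (x ⊓ y + t) := by
  rcases le_total y x with hyx | hxy
  · rw [sup_eq_left.2 hyx, inf_eq_right.2 hyx]
  · rw [sup_eq_right.2 hxy, inf_eq_left.2 hxy]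
    exact hlc.mul_le_mul_of_add_eq hnn (by linarith) (by linarith) (by ring)

theorem add_le_add_of_le_of_mul_le_mul {a b c d : ℝ} (hb : 0 ≤ b)
    (hd : 0 ≤ d) (hac : a ≤ c) (hbc : b ≤ c) (hmul : a * b ≤ c * d) : a + b ≤ c + d := by
  rcases eq_or_lt_of_le (hb.trans hbc) with hc | hc
  · linarith
  · refine le_of_mul_le_mul_left ?_ hc
    nlinarith [mul_nonneg (sub_nonneg.2 hac) (sub_nonneg.2 hbc)]

/-- A pointwise comparison of symmetrized products
yields a comparison of products of integrals. -/
theorem lintegral_mul_lintegral_le_of_symm {p q r w : ℝ → ℝ≥0∞} (hp : Measurable p)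
    (hq : Measurable q) (hr : Measurable r) (hw : Measurable w)
    (h : ∀ s t, p s * q t + p t * q s ≤ r s * w t + r t * w s) :
    (∫⁻ s, p s) * (∫⁻ s, q s) ≤ (∫⁻ s, r s) * (∫⁻ s, w s) := by
  have key {p q : ℝ → ℝ≥0∞} (hp : Measurable p) (hq : Measurable q) :
      ∫⁻ s, ∫⁻ t, (p s * q t + p t * q s) = 2 * ((∫⁻ s, p s) * ∫⁻ s, q s) := by
    have inner (s : ℝ) : ∫⁻ t, (p s * q t + p t * q s)
        = p s * (∫⁻ t, q t) + (∫⁻ t, p t) * q s := by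
      rw [lintegral_add_left (hq.const_mul _), lintegral_const_mul _ hq,
        lintegral_mul_const _ hp]
    simp_rw [inner]
    rw [lintegral_add_left (hp.mul_const _), lintegral_mul_const _ hp,
      lintegral_const_mul _ hq, two_mul]
  have h2 := lintegral_mono (μ := volume) fun s => lintegral_mono (μ := volume) (h s)
  rw [key hp hq, key hr hw] at h2
  exact (ENNReal.mul_le_mul_iff_right two_ne_zero ENNReal.ofNat_ne_top).1 h2

section ProductIntegral

variable {ι : Type*} [Fintype ι] {f : ι → ℝ → ℝ}

theorem prod_shift_symm_le (hnn : ∀ i x, 0 ≤ f i x) (hlc : ∀ i, LogConcaveFun (f i))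
    (x y : ι → ℝ) {s t : ℝ} (hst : s ≤ t) :
    (∏ i, f i (x i + s)) * (∏ i, f i (y i + t)) + (∏ i, f i (x i + t)) * (∏ i, f i (y i + s)) ≤
      (∏ i, f i ((x ⊔ y) i + s)) * (∏ i, f i ((x ⊓ y) i + t)) +
        (∏ i, f i ((x ⊔ y) i + t)) * (∏ i, f i ((x ⊓ y) i + s)) := by
  have nonneg (z : ι → ℝ) (u : ℝ) : 0 ≤ ∏ i, f i (z i + u) :=
    Finset.prod_nonneg fun i _ => hnn i _
  have shifted_le (x y : ι → ℝ) {s t : ℝ} (hst : s ≤ t) :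
      (∏ i, f i (x i + s)) * (∏ i, f i (y i + t)) ≤
        (∏ i, f i ((x ⊔ y) i + s)) * (∏ i, f i ((x ⊓ y) i + t)) := by
    simp_rw [← Finset.prod_mul_distrib]
    exact Finset.prod_le_prod (fun i _ => mul_nonneg (hnn i _) (hnn i _))
      fun i _ => (hlc i).mul_le_sup_mul_inf (hnn i) (x i) (y i) hst
  refine add_le_add_of_le_of_mul_le_mul (mul_nonneg (nonneg _ _) (nonneg _ _))
    (mul_nonneg (nonneg _ _) (nonneg _ _)) (shifted_le x y hst) ?_ ?_
  · have h := shifted_le y x hst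
    rw [sup_comm, inf_comm] at h
    linarith
  · have h := mul_le_mul (shifted_le x y (le_refl s)) (shifted_le x y (le_refl t))
      (mul_nonneg (nonneg _ _) (nonneg _ _)) (mul_nonneg (nonneg _ _) (nonneg _ _))
    linarith

theorem lintegral_prod_shift_logSupermodular (hmeas : ∀ i, Measurable (f i))
    (hnn : ∀ i x, 0 ≤ f i x) (hlc : ∀ i, LogConcaveFun (f i)) (x y : ι → ℝ) :
    (∫⁻ u : ℝ, ENNReal.ofReal (∏ i, f i (x i + u))) *
        (∫⁻ u : ℝ, ENNReal.ofReal (∏ i, f i (y i + u))) ≤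
      (∫⁻ u : ℝ, ENNReal.ofReal (∏ i, f i ((x ⊔ y) i + u))) *
        (∫⁻ u : ℝ, ENNReal.ofReal (∏ i, f i ((x ⊓ y) i + u))) := by
  have meas (z : ι → ℝ) : Measurable fun u : ℝ => ENNReal.ofReal (∏ i, f i (z i + u)) :=
    ENNReal.measurable_ofReal.comp <| Finset.measurable_fun_prod _ fun i _ =>
      (hmeas i).comp (measurable_const_add (z i))
  have nonneg (z : ι → ℝ) (u : ℝ) : 0 ≤ ∏ i, f i (z i + u) :=
    Finset.prod_nonneg fun i _ => hnn i _
  refine lintegral_mul_lintegral_le_of_symm (meas _) (meas _) (meas _) (meas _) fun s t => ?_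
  simp_rw [← ENNReal.ofReal_mul (nonneg _ _)]
  rw [← ENNReal.ofReal_add (mul_nonneg (nonneg _ _) (nonneg _ _))
      (mul_nonneg (nonneg _ _) (nonneg _ _)),
    ← ENNReal.ofReal_add (mul_nonneg (nonneg _ _) (nonneg _ _))
      (mul_nonneg (nonneg _ _) (nonneg _ _))]
  refine ENNReal.ofReal_le_ofReal ?_
  rcases le_total s t with hst | hts
  · exact prod_shift_symm_le hnn hlc x y hst
  · have h := prod_shift_symm_le hnn hlc x y hts
    linarith

theorem lintegral_prod_shift_add_const (f : ι → ℝ → ℝ) (z : ι → ℝ) (a : ℝ) :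
    ∫⁻ u : ℝ, ENNReal.ofReal (∏ i, f i (z i + a + u)) =
      ∫⁻ u : ℝ, ENNReal.ofReal (∏ i, f i (z i + u)) := by
  simp_rw [add_assoc]
  exact lintegral_add_left_eq_self (μ := (volume : Measure ℝ))
    (fun u => ENNReal.ofReal (∏ i, f i (z i + u))) a

end ProductIntegral

/-- Let `d = n + 1 ≥ 2` and `f₁, …, f_d : ℝ → [0,∞)` be Lebesgue-measurable
log-concave functions. Then `g : ℝ^{d−1} → [0,∞]`,
`g(x) = ∫ (∏_{i=1}^{d−1} f_i(x_i + u))·f_d(u) du` (Lebesgue integral, values in `[0,∞]`),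
is strongly MTP₂. -/
theorem differenceDensity_stronglyMTP2 (n : ℕ) (hn : 1 ≤ n)
    (f : Fin (n + 1) → ℝ → ℝ)
    (hmeas : ∀ i, Measurable (f i)) (hnn : ∀ i x, 0 ≤ f i x)
    (hlc : ∀ i, LogConcaveFun (f i)) :
    StronglyMTP2ENN (fun x : Fin n → ℝ =>
      ∫⁻ u : ℝ, ENNReal.ofReal
        ((∏ i : Fin n, f i.castSucc (x i + u)) * f (Fin.last n) u)) := by
  intro x y α hα
  have homog (z : Fin n → ℝ) : (∫⁻ u : ℝ, ENNReal.ofReal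
        ((∏ i : Fin n, f i.castSucc (z i + u)) * f (Fin.last n) u)) =
      ∫⁻ u : ℝ, ENNReal.ofReal
        (∏ i, f i ((Fin.snoc z 0 : Fin (n + 1) → ℝ) i + u)) := by
    simp [Fin.prod_univ_castSucc]
  have h := lintegral_prod_shift_logSupermodular hmeas hnn hlc
    (Fin.snoc x 0) (fun i => (Fin.snoc y 0 : Fin (n + 1) → ℝ) i + -α)
  rw [lintegral_prod_shift_add_const f (Fin.snoc y 0) (-α),
    ← lintegral_prod_shift_add_const f (_ ⊓ _) α] at h
  simp only [homog]
  convert h using 7 with u i _ u i _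
  · refine Fin.lastCases ?_ (fun j => ?_) i
    · simp [hα]
    · simp [sub_eq_add_neg]
  · refine Fin.lastCases ?_ (fun j => ?_) i
    · simp [hα]
    · simp [← min_add_add_right]
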